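/- The lower bound is indeed a lower bound on the ELBO: under the finite mixture setup, for any auxiliary conditional τ, J̃(τ) ≤ J. -/

import Mathlib

open MeasureTheory

/-- The log-sum inequality against a probability vector `t`. -/
theorem sum_mul_log_sub_log_le {O : Type*} [Fintype O] [Nonempty O] {a t : O → ℝ}
    (ha : ∀ o, 0 < a o) (ht : ∀ o, 0 < t o) (hsum : ∑ o, t o = 1) :
    ∑ o, a o * (Real.log (t o) - Real.log (a o)) ≤ -((∑ o, a o) * Real.log (∑ o, a o)) := by
  set S := ∑ o, a o with hS
  have hSpos : 0 < S := Finset.sum_pos (fun o _ => ha o) Finset.univ_nonempty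
  have hterm : ∀ o, a o * (Real.log (t o) - Real.log (a o))
      ≤ S * t o - a o - a o * Real.log S := by
    intro o
    have hlog := Real.log_le_sub_one_of_pos (div_pos (mul_pos hSpos (ht o)) (ha o))
    rw [Real.log_div (mul_pos hSpos (ht o)).ne' (ha o).ne',
      Real.log_mul hSpos.ne' (ht o).ne'] at hlog
    have hmul := mul_le_mul_of_nonneg_left hlog (ha o).le
    rw [mul_sub (a o) (S * t o / a o), mul_div_cancel₀ _ (ha o).ne'] at hmul
    linarith
  refine (Finset.sum_le_sum fun o _ => hterm o).trans_eq ?_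
  rw [Finset.sum_sub_distrib, Finset.sum_sub_distrib, ← Finset.mul_sum, ← Finset.sum_mul,
    hsum, ← hS]
  ring

/-- The lower bound is indeed a lower bound on the ELBO: for any auxiliary conditional `τ`,
`J̃(τ) ≤ J`. -/
theorem lowerBound_le_elbo
    {X : Type*} [MeasurableSpace X] (μ : Measure X)
    {O : Type*} [Fintype O] [Nonempty O]
    (w : O → ℝ) (c : O → X → ℝ) (ρ : X → ℝ) (τ : O → X → ℝ)
    -- finite mixture model
    (hwpos : ∀ o, 0 < w o) (hwsum : ∑ o, w o = 1)
    (hcmeas : ∀ o, Measurable (c o)) (hcpos : ∀ o x, 0 < c o x)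
    (hcnorm : ∀ o, ∫ x, c o x ∂μ = 1)
    (hρ : Measurable ρ)
    -- mixture density and responsibilities
    (q : X → ℝ) (hq : ∀ x, q x = ∑ o, w o * c o x)
    (r : O → X → ℝ) (hr : ∀ o x, r o x = w o * c o x / q x)
    -- auxiliary conditional
    (hτmeas : ∀ o, Measurable (τ o)) (hτpos : ∀ o x, 0 < τ o x)
    (hτsum : ∀ x, ∑ o, τ o x = 1)
    -- all integrals appearing exist
    (hintc : ∀ o, Integrable (c o) μ)
    (hint1 : ∀ o, Integrable (fun x => c o x * ρ x) μ)
    (hint2 : Integrable (fun x => q x * Real.log (q x)) μ)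
    (hint3 : ∀ o, Integrable
      (fun x => c o x * (ρ x + Real.log (τ o x) - Real.log (c o x))) μ)
    (hint4 : Integrable
      (fun x => q x * ∑ o, r o x * Real.log (r o x / τ o x)) μ) :
    (∑ o, w o * ((∫ x, c o x * (ρ x + Real.log (τ o x) - Real.log (c o x)) ∂μ)
        - Real.log (w o)))
      ≤ (∑ o, w o * ∫ x, c o x * ρ x ∂μ) - ∫ x, q x * Real.log (q x) ∂μ := by
  have hintL : ∀ o, Integrable (fun x => w o * (c o x * (ρ x + Real.log (τ o x)
      - Real.log (c o x)) - Real.log (w o) * c o x)) μ := fun o =>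
    ((hint3 o).sub ((hintc o).const_mul _)).const_mul _
  have hintR : ∀ o, Integrable (fun x => w o * (c o x * ρ x)) μ := fun o =>
    (hint1 o).const_mul _
  have hL : (∑ o, w o * ((∫ x, c o x * (ρ x + Real.log (τ o x) - Real.log (c o x)) ∂μ)
        - Real.log (w o)))
      = ∫ x, ∑ o, w o * (c o x * (ρ x + Real.log (τ o x)
        - Real.log (c o x)) - Real.log (w o) * c o x) ∂μ := by
    rw [integral_finsetSum _ fun o _ => hintL o]
    refine Finset.sum_congr rfl fun o _ => ?_
    rw [integral_const_mul, integral_sub (hint3 o) ((hintc o).const_mul _),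
      integral_const_mul, hcnorm, mul_one]
  have hR : (∑ o, w o * ∫ x, c o x * ρ x ∂μ) - ∫ x, q x * Real.log (q x) ∂μ
      = ∫ x, ((∑ o, w o * (c o x * ρ x)) - q x * Real.log (q x)) ∂μ := by
    rw [integral_sub (integrable_finsetSum _ fun o _ => hintR o) hint2,
      integral_finsetSum _ fun o _ => hintR o]
    simp only [integral_const_mul]
  rw [hL, hR]
  refine integral_mono (integrable_finsetSum _ fun o _ => hintL o)
    ((integrable_finsetSum _ fun o _ => hintR o).sub hint2) fun x => ?_
  have hgibbs := sum_mul_log_sub_log_le (fun o => mul_pos (hwpos o) (hcpos o x))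
    (fun o => hτpos o x) (hτsum x)
  rw [← hq x] at hgibbs
  have hsplit : ∑ o, w o * (c o x * (ρ x + Real.log (τ o x)
        - Real.log (c o x)) - Real.log (w o) * c o x)
      = (∑ o, w o * (c o x * ρ x))
        + ∑ o, w o * c o x * (Real.log (τ o x) - Real.log (w o * c o x)) := by
    rw [← Finset.sum_add_distrib]
    refine Finset.sum_congr rfl fun o _ => ?_
    rw [Real.log_mul (hwpos o).ne' (hcpos o x).ne']
    ring
  dsimp only
  linarith
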